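/- Let Σ' be a complete simplicial refinement of a complete fan Σ ⊂ R^n with the same 1-dimensional cones, and let z_1,...,z_{n+1} be the monomials associated to a complete flag σ_0 ⊂ σ_1 ⊂ ... ⊂ σ_n in Σ as above. Then there is a unique simplicial cone σ' ∈ Σ' of dimension n, generated by rays η_{i_1},...,η_{i_n}, such that x_{i_k} divides z_k for each k = 1,...,n, and such that on the toric variety X' of Σ' one has z_1 = ... = z_n = 0 if and only if x_{i_1} = ... = x_{i_n} = 0. -/

import Mathlib

open scoped Classical

noncomputable section

/-- `F` is a face of the pointed cone `σ`. -/
def IsFaceOf {n : ℕ} (F σ : PointedCone ℝ (Fin n → ℝ)) : Prop :=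
  F ≤ σ ∧ ∀ x ∈ σ, ∀ y ∈ σ, x + y ∈ F → x ∈ F ∧ y ∈ F

/-- A fan in `ℝ^n` whose rays are generated by `η 0, …, η (s-1)`. -/
structure Fan (n s : ℕ) where
  η : Fin s → (Fin n → ℝ)
  cones : Set (PointedCone ℝ (Fin n → ℝ))
  bot_mem : ⊥ ∈ cones
  face_mem : ∀ σ ∈ cones, ∀ F, IsFaceOf F σ → F ∈ cones
  inter_face : ∀ σ ∈ cones, ∀ τ ∈ cones, IsFaceOf (σ ⊓ τ) σ
  ray_gen : ∀ σ ∈ cones, (σ : Set (Fin n → ℝ)) ⊆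
      ↑(Submodule.span {c : ℝ // 0 ≤ c} {x | ∃ j, η j ∈ σ ∧ x = η j})

/-- The dimension of a cone: the dimension of its linear span. -/
def coneDim {n : ℕ} (σ : PointedCone ℝ (Fin n → ℝ)) : ℕ :=
  Module.finrank ℝ (Submodule.span ℝ (σ : Set (Fin n → ℝ)))

/-- A fan is simplicial if the ray generators of each of its cones are linearly
independent. -/
def Fan.Simplicial {n s : ℕ} (F : Fan n s) : Prop :=
  ∀ σ ∈ F.cones, LinearIndependent ℝ (fun j : {j : Fin s // F.η j ∈ σ} => F.η j)

lemma IsFaceOf.mem_of_sum_mem {n : ℕ} {F σ : PointedCone ℝ (Fin n → ℝ)} (hF : IsFaceOf F σ)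
    {α : Type*} [Fintype α] {c : α → ℝ} {y : α → Fin n → ℝ} (hc : ∀ a, 0 ≤ c a)
    (hy : ∀ a, y a ∈ σ) (hsum : ∑ a, c a • y a ∈ F) {a : α} (ha : 0 < c a) : y a ∈ F := by
  have hadd := Finset.add_sum_erase Finset.univ (fun a => c a • y a) (Finset.mem_univ a)
  rw [← hadd] at hsum
  exact (F.smul_mem_iff ha).1 (hF.2 _ (σ.smul_mem (hc a) (hy a)) _
    (Submodule.sum_mem _ fun b _ => σ.smul_mem (hc b) (hy b)) hsum).1

namespace Fan

variable {n s : ℕ} (S : Fan n s)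

lemma exists_eq_sum {σ : PointedCone ℝ (Fin n → ℝ)} (hσ : σ ∈ S.cones) {x : Fin n → ℝ}
    (hx : x ∈ σ) : ∃ c : {j // S.η j ∈ σ} → ℝ, (∀ j, 0 ≤ c j) ∧ ∑ j, c j • S.η j = x := by
  have h := S.ray_gen σ hσ hx
  clear hx
  induction h using Submodule.span_induction with
  | mem x h =>
    obtain ⟨j, hj, rfl⟩ := h
    refine ⟨Pi.single ⟨j, hj⟩ 1, fun i => ?_, ?_⟩
    · by_cases h : i = ⟨j, hj⟩
      · subst h; simp
      · simp [Pi.single_eq_of_ne h]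
    · rw [Finset.sum_eq_single ⟨j, hj⟩] <;> simp +contextual [Pi.single_eq_of_ne]
  | zero => exact ⟨0, by simp, by simp⟩
  | add x y _ _ hx hy =>
    obtain ⟨c, hc, rfl⟩ := hx
    obtain ⟨d, hd, rfl⟩ := hy
    exact ⟨c + d, fun j => add_nonneg (hc j) (hd j), by simp [add_smul, Finset.sum_add_distrib]⟩
  | smul a x _ hx =>
    obtain ⟨c, hc, rfl⟩ := hx
    refine ⟨fun j => a * c j, fun j => mul_nonneg a.2 (hc j), ?_⟩
    simp only [mul_smul, ← Finset.smul_sum]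
    rfl

lemma eq_of_forall_mem_iff {σ τ : PointedCone ℝ (Fin n → ℝ)} (hσ : σ ∈ S.cones)
    (hτ : τ ∈ S.cones) (h : ∀ j, S.η j ∈ σ ↔ S.η j ∈ τ) : σ = τ := by
  refine le_antisymm (fun x hx => ?_) fun x hx => ?_
  · obtain ⟨c, hc, rfl⟩ := S.exists_eq_sum hσ hx
    exact Submodule.sum_mem _ fun j _ => τ.smul_mem (hc j) ((h j).1 j.2)
  · obtain ⟨c, hc, rfl⟩ := S.exists_eq_sum hτ hx
    exact Submodule.sum_mem _ fun j _ => σ.smul_mem (hc j) ((h j).2 j.2)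

variable {S}

lemma isFaceOf_of_le {σ τ : PointedCone ℝ (Fin n → ℝ)} (hσ : σ ∈ S.cones)
    (hτ : τ ∈ S.cones) (h : σ ≤ τ) : IsFaceOf σ τ := by
  have := S.inter_face τ hτ σ hσ
  rwa [inf_eq_right.2 h] at this

lemma Simplicial.isClosed (hS : S.Simplicial) {σ : PointedCone ℝ (Fin n → ℝ)}
    (hσ : σ ∈ S.cones) : IsClosed (σ : Set (Fin n → ℝ)) := by
  set T := Fintype.linearCombination ℝ (fun j : {j // S.η j ∈ σ} => S.η j) with hT
  have hker : LinearMap.ker T = ⊥ := LinearMap.ker_eq_bot'.2 fun c hc =>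
    funext (Fintype.linearIndependent_iff.1 (hS σ hσ) c hc)
  obtain ⟨g, hg⟩ := T.exists_leftInverse_of_injective hker
  have hgT : ∀ c, g (T c) = c := fun c => LinearMap.congr_fun hg c
  have key : (σ : Set (Fin n → ℝ)) = {x | T (g x) = x} ∩ {x | 0 ≤ g x} := by
    ext x
    constructor
    · intro hx
      obtain ⟨c, hc, rfl⟩ := S.exists_eq_sum hσ hx
      rw [← Fintype.linearCombination_apply ℝ (fun j : {j // S.η j ∈ σ} => S.η j), ← hT]
      exact ⟨by simp [hgT], Set.mem_ofPred.2 (by rwa [hgT])⟩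
    · rintro ⟨h1, h2⟩
      rw [← Set.mem_ofPred.1 h1, hT, Fintype.linearCombination_apply]
      exact Submodule.sum_mem _ fun j _ => σ.smul_mem (h2 j) j.2
  rw [key]
  have hg' := g.continuous_of_finiteDimensional
  have hT' := T.continuous_of_finiteDimensional
  exact (isClosed_eq (hT'.comp hg') continuous_id).inter (isClosed_le continuous_const hg')

lemma Simplicial.injective_linearIndependent (hS : S.Simplicial)
    {σ : PointedCone ℝ (Fin n → ℝ)} (hσ : σ ∈ S.cones) {α : Type*} {ι : α → Fin s}
    (hι : Function.Injective ι) (hmem : ∀ a, S.η (ι a) ∈ σ) :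
    LinearIndependent ℝ fun a => S.η (ι a) :=
  (hS σ hσ).comp (fun a => ⟨ι a, hmem a⟩) fun _ _ h => hι (congrArg Subtype.val h)

/-- In a complete simplicial fan, some cone contains both `p` and `p + ε w` for
arbitrarily small `ε > 0`. -/
lemma Simplicial.exists_mem_add_smul_mem (hS : S.Simplicial)
    (hcomplete : ∀ x : Fin n → ℝ, ∃ σ ∈ S.cones, x ∈ σ) (p w : Fin n → ℝ) :
    ∃ τ ∈ S.cones, p ∈ τ ∧ ∃ ε : ℝ, 0 < ε ∧ p + ε • w ∈ τ := by
  choose τ hτ hmem using fun m : ℕ => hcomplete (p + (1 / ((m : ℝ) + 1)) • w)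
  obtain ⟨A, hA⟩ := Finite.exists_infinite_fiber fun m => {j | S.η j ∈ τ m}
  rw [Set.infinite_coe_iff] at hA
  obtain ⟨m₀, hm₀⟩ := hA.nonempty
  refine ⟨τ m₀, hτ m₀, ?_, 1 / ((m₀ : ℝ) + 1), by positivity, hmem m₀⟩
  have hlim : Filter.Tendsto (fun m : ℕ => p + (1 / ((m : ℝ) + 1)) • w) Filter.atTop
      (nhds p) := by
    simpa using (tendsto_one_div_add_atTop_nhds_zero_nat (𝕜 := ℝ)).smul_const w |>.const_add p
  refine (hS.isClosed (hτ m₀)).mem_of_frequently_of_tendsto ?_ hlim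
  refine (Nat.frequently_atTop_iff_infinite.2 hA).mono fun m hm => ?_
  have : τ m = τ m₀ := S.eq_of_forall_mem_iff (hτ m) (hτ m₀) fun j =>
    Set.ext_iff.1 (hm.trans hm₀.symm) j
  exact this ▸ hmem m

/-- A complete flag of cones of a fan. -/
structure IsFlag (S : Fan n s) (σ : Fin (n + 1) → PointedCone ℝ (Fin n → ℝ)) : Prop where
  mem : ∀ i, σ i ∈ S.cones
  le_succ : ∀ i : Fin n, σ i.castSucc ≤ σ i.succ
  dim : ∀ i, coneDim (σ i) = (i : ℕ)

/-- The `j`-th ray lies in the `(i+1)`-st cone of `σ` but not in the `i`-th one. -/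
def AtLevel (S : Fan n s) (σ : Fin (n + 1) → PointedCone ℝ (Fin n → ℝ)) (i : Fin n)
    (j : Fin s) : Prop :=
  S.η j ∈ σ i.succ ∧ S.η j ∉ σ i.castSucc

namespace IsFlag

variable {σ : Fin (n + 1) → PointedCone ℝ (Fin n → ℝ)}

lemma monotone (hσ : S.IsFlag σ) : Monotone σ := Fin.monotone_iff_le_succ.2 hσ.le_succ

lemma level_unique (hσ : S.IsFlag σ) {i k : Fin n} {j : Fin s} (hi : S.AtLevel σ i j)
    (hk : S.AtLevel σ k j) : i = k := by
  by_contra h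
  rcases lt_or_gt_of_ne h with h | h
  · exact hk.2 (hσ.monotone (by simpa [Fin.le_def] using h) hi.1)
  · exact hi.2 (hσ.monotone (by simpa [Fin.le_def] using h) hk.1)

lemma injective (hσ : S.IsFlag σ) {ι : Fin n → Fin s} (hι : ∀ i, S.AtLevel σ i (ι i)) :
    Function.Injective ι :=
  fun i k h => hσ.level_unique (hι i) (h ▸ hι k)

lemma not_succ_le (hσ : S.IsFlag σ) (i : Fin n) : ¬ σ i.succ ≤ σ i.castSucc := fun h => by
  have h' := le_antisymm h (hσ.le_succ i)
  have h1 := hσ.dim i.succ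
  rw [h', hσ.dim] at h1
  simp at h1

lemma exists_eq_sum (hσ : S.IsFlag σ) {ι : Fin n → Fin s} (hι : ∀ i, S.AtLevel σ i (ι i))
    (hli : LinearIndependent ℝ fun i => S.η (ι i)) {k : Fin n} {x : Fin n → ℝ}
    (hx : x ∈ σ k.succ) : ∃ a : Set.Iic k → ℝ, ∑ l, a l • S.η (ι l) = x := by
  have hle : Submodule.span ℝ (Set.range fun l : Set.Iic k => S.η (ι l)) ≤
      Submodule.span ℝ (σ k.succ : Set (Fin n → ℝ)) := by
    refine Submodule.span_mono ?_
    rintro _ ⟨l, rfl⟩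
    exact hσ.monotone (Fin.succ_le_succ_iff.2 l.2) (hι l).1
  have heq := Submodule.eq_of_le_of_finrank_eq hle (by
    rw [finrank_span_eq_card (b := fun l : Set.Iic k => S.η (ι l))
      (hli.comp _ Subtype.val_injective)]
    have := hσ.dim k.succ
    rw [coneDim] at this
    rw [this]
    simp)
  have hx' := Submodule.subset_span (R := ℝ) hx
  rw [← heq] at hx'
  exact (Submodule.mem_span_range_iff_exists_fun ℝ).1 hx'

variable {S' : Fan n s}

/-- Cones of a simplicial fan with one ray at each level are determined inductively: if a cone
`τ` contains the first `k` rays of such a cone and some ray at level `k`, then it contains the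
`k`-th ray as well. -/
lemma ray_mem (hσ : S.IsFlag σ) (hη : S'.η = S.η) (hS' : S'.Simplicial)
    {σ' τ : PointedCone ℝ (Fin n → ℝ)}
    (hσ' : σ' ∈ S'.cones) (hτ : τ ∈ S'.cones) {ι : Fin n → Fin s}
    (hι : ∀ i, S.AtLevel σ i (ι i)) (hmem : ∀ i, S.η (ι i) ∈ σ') {k : Fin n} {j : Fin s}
    (hj : S.AtLevel σ k j) (hjτ : S.η j ∈ τ) (hlt : ∀ l < k, S.η (ι l) ∈ τ) :
    S.η (ι k) ∈ τ := by
  have hli := hS'.injective_linearIndependent hσ' (hσ.injective hι) (by rwa [hη])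
  rw [hη] at hli
  obtain ⟨a, ha⟩ := hσ.exists_eq_sum hι hli hj.1
  have hid : S.η j + ∑ l, (a l)⁻ • S.η (ι l) = ∑ l, (a l)⁺ • S.η (ι l) := by
    rw [← ha, ← Finset.sum_add_distrib]
    refine Finset.sum_congr rfl fun l _ => ?_
    rw [← add_smul]
    congr 1
    linarith [posPart_sub_negPart (a l)]
  have hcases : ∀ l : Set.Iic k, (l : Fin n) < k ∨ l = ⟨k, Set.self_mem_Iic⟩ := fun l =>
    (lt_or_eq_of_le l.2).imp_right Subtype.ext
  rcases lt_or_ge 0 (a ⟨k, Set.self_mem_Iic⟩) with hk | hk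
  · have hL : S.η j + ∑ l, (a l)⁻ • S.η (ι l) ∈ τ := by
      refine add_mem hjτ (Submodule.sum_mem _ fun l _ => ?_)
      rcases hcases l with h | rfl
      · exact τ.smul_mem (negPart_nonneg _) (hlt _ h)
      · simp [negPart_eq_zero.2 hk.le]
    rw [hid] at hL
    have hR : ∑ l, (a l)⁺ • S.η (ι l) ∈ σ' :=
      Submodule.sum_mem _ fun l _ => σ'.smul_mem (posPart_nonneg _) (hmem _)
    exact ((S'.inter_face σ' hσ' τ hτ).mem_of_sum_mem (fun l => posPart_nonneg (a l))
      (fun l => hmem l) (Submodule.mem_inf.2 ⟨hR, hL⟩) (a := ⟨k, Set.self_mem_Iic⟩)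
      (posPart_pos hk)).2
  · have hR : ∑ l, (a l)⁺ • S.η (ι l) ∈ σ k.castSucc := by
      refine Submodule.sum_mem _ fun l _ => ?_
      rcases hcases l with h | rfl
      · exact (σ _).smul_mem (posPart_nonneg _)
          (hσ.monotone (by simpa [Fin.le_def] using h) (hι l).1)
      · simp [posPart_eq_zero.2 hk]
    rw [← hid] at hR
    refine absurd ((isFaceOf_of_le (hσ.mem _) (hσ.mem _) (hσ.le_succ k)).2 _ hj.1 _
      (Submodule.sum_mem _ fun l _ => (σ _).smul_mem (negPart_nonneg _) ?_) hR).1 hj.2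
    exact hσ.monotone (Fin.succ_le_succ_iff.2 l.2) (hι l).1

lemma ray_mem_of_forall (hσ : S.IsFlag σ) (hη : S'.η = S.η) (hS' : S'.Simplicial)
    {σ' τ : PointedCone ℝ (Fin n → ℝ)} (hσ' : σ' ∈ S'.cones) (hτ : τ ∈ S'.cones)
    {ι κ : Fin n → Fin s} (hι : ∀ i, S.AtLevel σ i (ι i)) (hmem : ∀ i, S.η (ι i) ∈ σ')
    (hκ : ∀ i, S.AtLevel σ i (κ i)) (hκτ : ∀ i, S.η (κ i) ∈ τ) (i : Fin n) :
    S.η (ι i) ∈ τ := by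
  induction i using WellFoundedLT.induction with
  | ind k ih => exact hσ.ray_mem hη hS' hσ' hτ hι hmem (hκ k) (hκτ k) ih

lemma setOf_ray_mem_eq_range (hσ : S.IsFlag σ) (hη : S'.η = S.η) (hS' : S'.Simplicial)
    {τ : PointedCone ℝ (Fin n → ℝ)} (hτ : τ ∈ S'.cones) {ι : Fin n → Fin s}
    (hι : ∀ i, S.AtLevel σ i (ι i)) (hmem : ∀ i, S.η (ι i) ∈ τ) :
    {j | S.η j ∈ τ} = Set.range ι := by
  symm
  refine Set.eq_of_subset_of_ncard_le ?_ ?_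
  · rintro _ ⟨i, rfl⟩
    exact hmem i
  · have h := (hS' τ hτ).fintype_card_le_finrank
    rw [hη, ← Nat.card_eq_fintype_card, Module.finrank_fin_fun] at h
    rw [← Set.image_univ, Set.ncard_image_of_injective _ (hσ.injective hι), Set.ncard_univ,
      ← Nat.card_coe_set_eq, Nat.card_fin]
    exact h

lemma coneDim_eq (hσ : S.IsFlag σ) (hη : S'.η = S.η) (hS' : S'.Simplicial)
    {τ : PointedCone ℝ (Fin n → ℝ)} (hτ : τ ∈ S'.cones) {ι : Fin n → Fin s}
    (hι : ∀ i, S.AtLevel σ i (ι i)) (hmem : ∀ i, S.η (ι i) ∈ τ) : coneDim τ = n := by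
  have hli := hS'.injective_linearIndependent hτ (hσ.injective hι) (by rwa [hη])
  rw [hη] at hli
  refine le_antisymm ((Submodule.finrank_le _).trans (by simp)) ?_
  calc n = Module.finrank ℝ (Submodule.span ℝ (Set.range fun i => S.η (ι i))) := by
        rw [finrank_span_eq_card hli, Fintype.card_fin]
    _ ≤ coneDim τ := Submodule.finrank_mono (Submodule.span_mono (by
        rintro _ ⟨i, rfl⟩
        exact hmem i))

/-- In a simplicial refinement, cones having one ray at each level are unique. -/
lemma eq_of_rays (hσ : S.IsFlag σ) (hη : S'.η = S.η) (hS' : S'.Simplicial)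
    {σ' τ : PointedCone ℝ (Fin n → ℝ)} (hσ' : σ' ∈ S'.cones) (hτ : τ ∈ S'.cones)
    {ι κ : Fin n → Fin s} (hι : ∀ i, S.AtLevel σ i (ι i)) (hmem : ∀ i, S.η (ι i) ∈ σ')
    (hκ : ∀ i, S.AtLevel σ i (κ i)) (hκτ : ∀ i, S.η (κ i) ∈ τ) : σ' = τ := by
  have h := hσ.setOf_ray_mem_eq_range hη hS' hσ' hι hmem
  rw [← hσ.setOf_ray_mem_eq_range hη hS' hτ hι
    (hσ.ray_mem_of_forall hη hS' hσ' hτ hι hmem hκ hκτ)] at h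
  exact S'.eq_of_forall_mem_iff hσ' hτ fun j => hη ▸ Set.ext_iff.1 h j

lemma exists_cone (hσ : S.IsFlag σ) (hη : S'.η = S.η) (hS' : S'.Simplicial)
    (hcomplete : ∀ x : Fin n → ℝ, ∃ τ ∈ S'.cones, x ∈ τ)
    (href : ∀ τ ∈ S'.cones, ∃ ρ ∈ S.cones, τ ≤ ρ) (k : ℕ) (hk : k ≤ n) :
    ∃ τ ∈ S'.cones, ∀ i : Fin n, (i : ℕ) < k → ∃ j, S.AtLevel σ i j ∧ S.η j ∈ τ := by
  induction k with
  | zero => exact ⟨⊥, S'.bot_mem, by simp⟩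
  | succ k ih =>
    obtain ⟨τ, hτ, hrays⟩ := ih (by omega)
    set K : Fin n := ⟨k, hk⟩
    choose ι hι hιτ using fun i : Set.Iio K => hrays i i.2
    obtain ⟨w, hw, hw'⟩ := SetLike.not_le_iff_exists.1 (hσ.not_succ_le K)
    have hp : ∑ i, (1 : ℝ) • S.η (ι i) ∈ τ :=
      Submodule.sum_mem _ fun i _ => τ.smul_mem zero_le_one (hιτ i)
    have hpσ : ∑ i, (1 : ℝ) • S.η (ι i) ∈ σ K.succ :=
      Submodule.sum_mem _ fun i _ => (σ _).smul_mem zero_le_one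
        (hσ.monotone (Fin.succ_le_succ_iff.2 (le_of_lt i.2)) (hι i).1)
    obtain ⟨τ₂, hτ₂, hpτ₂, ε, hε, hq⟩ := hS'.exists_mem_add_smul_mem hcomplete
      (∑ i, (1 : ℝ) • S.η (ι i)) w
    refine ⟨τ₂, hτ₂, fun i hi => ?_⟩
    rcases Nat.lt_succ_iff_lt_or_eq.1 hi with hi | hi
    · exact ⟨ι ⟨i, hi⟩, hι ⟨i, hi⟩, ((S'.inter_face τ hτ τ₂ hτ₂).mem_of_sum_mem
        (fun _ => zero_le_one) hιτ (Submodule.mem_inf.2 ⟨hp, hpτ₂⟩) zero_lt_one).2⟩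
    · obtain rfl : i = K := Fin.ext hi
      have hqσ := add_mem hpσ ((σ _).smul_mem hε.le hw)
      have hqσ' : _ ∉ σ K.castSucc := fun h => hw' <| ((σ _).smul_mem_iff hε).1
        ((isFaceOf_of_le (hσ.mem _) (hσ.mem _) (hσ.le_succ K)).2 _ hpσ _
          ((σ _).smul_mem hε.le hw) h).2
      obtain ⟨ρ, hρ, hle⟩ := href τ₂ hτ₂
      obtain ⟨c, hc, hsum⟩ := S'.exists_eq_sum hτ₂ hq
      simp only [hη] at hsum
      by_contra! hcon
      refine hqσ' ?_
      rw [← hsum]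
      refine Submodule.sum_mem _ fun j _ => ?_
      rcases (hc j).eq_or_lt with h0 | h0
      · simp [← h0]
      · refine (σ _).smul_mem h0.le ?_
        have hjτ : S.η j ∈ τ₂ := hη ▸ j.2
        have hjσ := ((S.inter_face ρ hρ _ (hσ.mem K.succ)).mem_of_sum_mem hc
          (fun j => hle (hη ▸ j.2)) (Submodule.mem_inf.2
            ⟨hsum ▸ hle hq, hsum ▸ hqσ⟩) h0).2
        by_contra hj
        exact hcon j ⟨hjσ, hj⟩ hjτ

end IsFlag

end Fan

lemma MvPolynomial.X_dvd_prod_X {α R : Type*} [CommRing R] [IsDomain R] {A : Finset α} {i : α}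
    (h : (X i : MvPolynomial α R) ∣ ∏ j ∈ A, X j) : i ∈ A := by
  have h' := map_dvd (eval fun j => if j = i then (0 : R) else 1) h
  simp only [eval_X, if_true, map_prod, zero_dvd_iff, Finset.prod_eq_zero_iff] at h'
  obtain ⟨j, hj, h⟩ := h'
  by_cases hji : j = i
  · exact hji ▸ hj
  · simp [hji] at h

/-- Let `Sig'` be a complete simplicial refinement of the complete fan
`Sig ⊂ ℝ^n` with the same rays, and let `z 1, …, z (n+1)` be the monomials
associated to a complete flag `σ 0 ⊂ σ 1 ⊂ ⋯ ⊂ σ n` in `Sig`.  Then there is a unique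
`n`-dimensional simplicial cone `σ' ∈ Sig'`, with rays `η (ι 1), …, η (ι n)`, such that
`x (ι k)` divides `z k` for each `k`, and such that on the toric variety `X'` of `Sig'`
(whose points are Cox coordinate vectors not vanishing on the irrelevant ideal of `Sig'`)
one has `z 1 = ⋯ = z n = 0` iff `x (ι 1) = ⋯ = x (ι n) = 0`. -/
theorem statement2 {n s : ℕ} (Sig Sig' : Fan n s)
    (hη : Sig'.η = Sig.η)
    (hcomplete : ∀ x : Fin n → ℝ, ∃ σ ∈ Sig.cones, x ∈ σ)
    (hcomplete' : ∀ x : Fin n → ℝ, ∃ σ ∈ Sig'.cones, x ∈ σ)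
    (href : ∀ σ' ∈ Sig'.cones, ∃ σ ∈ Sig.cones, σ' ≤ σ)
    (hsimp : Sig'.Simplicial)
    (σ : Fin (n + 1) → PointedCone ℝ (Fin n → ℝ))
    (hmem : ∀ i, σ i ∈ Sig.cones)
    (h0 : σ 0 = ⊥)
    (hflag : ∀ i : Fin n, σ i.castSucc ≤ σ i.succ)
    (hdim : ∀ i : Fin (n + 1), coneDim (σ i) = (i : ℕ))
    (z : Fin n → MvPolynomial (Fin s) ℂ)
    (hz : ∀ i : Fin n, z i =
      ∏ j ∈ Finset.univ.filter
        (fun j => Sig.η j ∈ σ i.succ ∧ Sig.η j ∉ σ i.castSucc), MvPolynomial.X j) :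
    ∃! σ' : PointedCone ℝ (Fin n → ℝ), σ' ∈ Sig'.cones ∧ coneDim σ' = n ∧
      ∃ ι : Fin n → Fin s, Function.Injective ι ∧
        {j : Fin s | Sig.η j ∈ σ'} = Set.range ι ∧
        (∀ i : Fin n, MvPolynomial.X (ι i) ∣ z i) ∧
        ∀ x : Fin s → ℂ,
          (∃ τ ∈ Sig'.cones, coneDim τ = n ∧
              (∏ j ∈ Finset.univ.filter (fun j => Sig.η j ∉ τ), x j) ≠ 0) →
          ((∀ i : Fin n, MvPolynomial.eval x (z i) = 0) ↔ ∀ i : Fin n, x (ι i) = 0) := by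
  have hσ : Sig.IsFlag σ := ⟨hmem, hflag, hdim⟩
  have hdvd : ∀ i j, MvPolynomial.X j ∣ z i ↔ Sig.AtLevel σ i j := fun i j => by
    rw [hz]
    refine ⟨fun h => ?_, fun h => Finset.dvd_prod_of_mem _ (Finset.mem_filter.2 ⟨by simp, h⟩)⟩
    exact (Finset.mem_filter.1 (MvPolynomial.X_dvd_prod_X h)).2
  obtain ⟨τ, hτ, hrays⟩ := hσ.exists_cone hη hsimp hcomplete' href n le_rfl
  choose ι hι hιτ using fun i : Fin n => hrays i i.2
  refine ⟨τ, ⟨hτ, hσ.coneDim_eq hη hsimp hτ hι hιτ, ι, hσ.injective hι,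
    hσ.setOf_ray_mem_eq_range hη hsimp hτ hι hιτ, fun i => (hdvd i _).2 (hι i), ?_⟩, ?_⟩
  · rintro x ⟨ρ, hρ, -, hx⟩
    have hzero : ∀ j, x j = 0 → Sig.η j ∈ ρ := fun j hj => by
      by_contra h
      exact hx (Finset.prod_eq_zero (Finset.mem_filter.2 ⟨Finset.mem_univ j, h⟩) hj)
    constructor
    · intro h
      have hex : ∀ i, ∃ j, Sig.AtLevel σ i j ∧ x j = 0 := fun i => by
        have := h i
        rw [hz, map_prod, Finset.prod_eq_zero_iff] at this
        simpa [Fan.AtLevel] using this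
      choose κ hκ hκx using hex
      have hκρ := fun i => hzero _ (hκx i)
      obtain rfl := hσ.eq_of_rays hη hsimp hτ hρ hι hιτ hκ hκρ
      intro i
      have hi : κ i ∈ {j | Sig.η j ∈ τ} := hκρ i
      rw [hσ.setOf_ray_mem_eq_range hη hsimp hτ hι hιτ] at hi
      obtain ⟨l, hl⟩ := hi
      obtain rfl := hσ.level_unique (hl ▸ hι l) (hκ i)
      rw [hl, hκx]
    · intro h i
      obtain ⟨q, hq⟩ := (hdvd i _).2 (hι i)
      simp [hq, h i]
  · rintro ρ ⟨hρ, -, κ, -, hκρ, hκ, -⟩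
    exact (hσ.eq_of_rays hη hsimp hτ hρ hι hιτ (fun i => (hdvd i _).1 (hκ i)) fun i =>
      hκρ.ge (Set.mem_range_self i)).symm
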